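/- arXiv:1907.06883 — 4 statements merged into one kernel-verified Lean document; each statement's English description precedes it below -/
import Mathlib

section
/- Let A ∈ ℝⁿˣⁿ and B ∈ ℝⁿˣᵐ. There exists K ∈ ℝᵐˣⁿ such that A − BK is stable if and only if there exist J skew-symmetric, R ⪰ 0, Q ≻ 0 (all n×n) such that (Iₙ − B B†)(A − (J − R)Q) = 0. -/
open Matrix

noncomputable section

/-- A real square matrix is *stable* if every eigenvalue (over ℂ) has nonpositive
real part, and eigenvalues on the imaginary axis are semisimple
(i.e. ker((A-μI)²) = ker(A-μI)). -/
def Matrix.IsStable {n : Type*} [Fintype n] [DecidableEq n] (A : Matrix n n ℝ) : Prop :=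
  ∀ μ : ℂ, (A.map Complex.ofReal - μ • (1 : Matrix n n ℂ)).det = 0 →
    μ.re ≤ 0 ∧ (μ.re = 0 →
      ∀ v : n → ℂ,
        ((A.map Complex.ofReal - μ • 1) * (A.map Complex.ofReal - μ • 1)).mulVec v = 0 →
        (A.map Complex.ofReal - μ • 1).mulVec v = 0)

/-- `Ad` is the Moore–Penrose pseudoinverse of the real matrix `A`. -/
def IsMoorePenrose {m n : Type*} [Fintype m] [Fintype n]
    (A : Matrix m n ℝ) (Ad : Matrix n m ℝ) : Prop :=
  A * Ad * A = A ∧ Ad * A * Ad = Ad ∧ (A * Ad).IsHermitian ∧ (Ad * A).IsHermitian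

namespace Matrix

open Polynomial
open scoped ComplexOrder

variable {n : Type*}

theorem IsHermitian.map_re {P : Matrix n n ℂ} (hP : P.IsHermitian) :
    (P.map Complex.re).IsHermitian := by
  ext i j
  simpa using congrArg Complex.re (hP.apply i j)

variable [Fintype n]

theorem dotProduct_map_re_mulVec (P : Matrix n n ℂ) (x : n → ℝ) :
    star x ⬝ᵥ P.map Complex.re *ᵥ x =
      (star (fun i => (x i : ℂ)) ⬝ᵥ P *ᵥ (fun i => (x i : ℂ))).re := by
  simp [dotProduct, mulVec, Finset.mul_sum, mul_comm]

theorem PosSemidef.map_re {P : Matrix n n ℂ} (hP : P.PosSemidef) :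
    (P.map Complex.re).PosSemidef := by
  refine .of_dotProduct_mulVec_nonneg hP.isHermitian.map_re fun x => ?_
  rw [dotProduct_map_re_mulVec]
  exact (Complex.le_def.1 (hP.dotProduct_mulVec_nonneg _)).1

theorem PosDef.map_re {P : Matrix n n ℂ} (hP : P.PosDef) : (P.map Complex.re).PosDef := by
  refine .of_dotProduct_mulVec_pos hP.isHermitian.map_re fun x hx => ?_
  rw [dotProduct_map_re_mulVec]
  refine (Complex.lt_def.1 (hP.dotProduct_mulVec_pos fun h => hx ?_)).1
  ext i
  simpa using congrFun h i

theorem PosSemidef.map_ofReal {S : Matrix n n ℝ} (hS : S.PosSemidef) :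
    (S.map Complex.ofReal).PosSemidef := by
  obtain ⟨m, v, rfl⟩ := posSemidef_iff_eq_sum_vecMulVec.1 hS
  have h : (∑ i, vecMulVec (v i) (star (v i))).map Complex.ofReal =
      ∑ i, vecMulVec (fun j => (v i j : ℂ)) (star fun j => (v i j : ℂ)) := by
    ext j k
    simp [Matrix.sum_apply, vecMulVec_apply]
  rw [h]
  exact posSemidef_sum _ fun i _ => posSemidef_vecMulVec_self_star _

/-- Block Lyapunov certificate for a chain `U 0, …, U (d + 1)` of left generalised
eigen-matrices of `M`. -/
theorem exists_lyapunov_of_chain (M : Matrix n n ℂ) (U : ℕ → Matrix n n ℂ) (a : ℂ)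
    (ha : a.re < 0) (hU : ∀ k, U k * M = a • U k + U (k + 1)) (d : ℕ) :
    ∃ P : Matrix n n ℂ, (P - (U 0)ᴴ * U 0).PosSemidef ∧
      (-(P * M + Mᴴ * P) + (-a.re * (a.re ^ 2)⁻¹ ^ (d + 1) : ℝ) •
        ((U (d + 1))ᴴ * U (d + 1))).PosSemidef := by
  have hU' (k : ℕ) : Mᴴ * (U k)ᴴ = star a • (U k)ᴴ + (U (k + 1))ᴴ := by
    rw [← conjTranspose_mul, hU, conjTranspose_add, conjTranspose_smul]
  have hlyap (k : ℕ) : (U k)ᴴ * U k * M + Mᴴ * ((U k)ᴴ * U k) =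
      (2 * a.re : ℝ) • ((U k)ᴴ * U k) + ((U k)ᴴ * U (k + 1) + (U (k + 1))ᴴ * U k) := by
    have h2 : ((2 * a.re : ℝ) : ℂ) = a + star a := by
      simp [Complex.add_conj]
    rw [Matrix.mul_assoc, hU, ← Matrix.mul_assoc, hU', ← Complex.coe_smul, h2]
    simp only [Matrix.mul_add, Matrix.add_mul, Matrix.mul_smul, Matrix.smul_mul, add_smul]
    abel
  have hsq (k : ℕ) : ((-a.re) • ((U k + (a.re⁻¹) • U (k + 1))ᴴ *
      (U k + (a.re⁻¹) • U (k + 1)))).PosSemidef :=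
    (posSemidef_conjTranspose_mul_self _).smul (by linarith)
  have hexp (k : ℕ) : (-a.re) • ((U k + (a.re⁻¹) • U (k + 1))ᴴ *
      (U k + (a.re⁻¹) • U (k + 1))) = (-a.re) • ((U k)ᴴ * U k) -
      ((U k)ᴴ * U (k + 1) + (U (k + 1))ᴴ * U k) +
      (-a.re * (a.re ^ 2)⁻¹) • ((U (k + 1))ᴴ * U (k + 1)) := by
    simp only [conjTranspose_add, conjTranspose_smul, Matrix.mul_add, Matrix.add_mul,
      Matrix.mul_smul, Matrix.smul_mul, star_trivial]
    match_scalars <;> field_simp [ha.ne]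
  induction d with
  | zero =>
    refine ⟨(U 0)ᴴ * U 0, by simpa using PosSemidef.zero, ?_⟩
    have h1 : ((-a.re) • ((U 0)ᴴ * U 0)).PosSemidef :=
      (posSemidef_conjTranspose_mul_self _).smul (by linarith)
    convert h1.add (hsq 0) using 1
    rw [hexp, hlyap]
    module
  | succ d ih =>
    obtain ⟨P, hP, hL⟩ := ih
    have hs : 0 ≤ (a.re ^ 2)⁻¹ ^ (d + 1) := by positivity
    refine ⟨P + ((a.re ^ 2)⁻¹ ^ (d + 1) : ℝ) • ((U (d + 1))ᴴ * U (d + 1)), ?_, ?_⟩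
    · convert hP.add ((posSemidef_conjTranspose_mul_self (U (d + 1))).smul hs) using 1
      abel
    · convert hL.add ((hsq (d + 1)).smul hs) using 1
      have h3 := hlyap (d + 1)
      rw [hexp, Matrix.add_mul, Matrix.mul_add, Matrix.smul_mul, Matrix.mul_smul,
        add_add_add_comm, ← smul_add, h3]
      module

variable [DecidableEq n]

/-- A complex matrix satisfies the spectral stability condition. -/
def IsSpectrallyStable (M : Matrix n n ℂ) : Prop :=
  ∀ μ : ℂ, (M - μ • (1 : Matrix n n ℂ)).det = 0 →
    μ.re ≤ 0 ∧ (μ.re = 0 → ∀ v : n → ℂ,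
      ((M - μ • 1) * (M - μ • 1)) *ᵥ v = 0 → (M - μ • 1) *ᵥ v = 0)

theorem mul_eq_zero_of_pow_mul_eq_zero {N X : Matrix n n ℂ}
    (hN : ∀ v : n → ℂ, (N * N) *ᵥ v = 0 → N *ᵥ v = 0) (d : ℕ) (h : N ^ (d + 1) * X = 0) :
    N * X = 0 := by
  have key : ∀ v : n → ℂ, N ^ (d + 1) *ᵥ v = 0 → N *ᵥ v = 0 := by
    clear h
    induction d with
    | zero => simp
    | succ d ih =>
      refine fun v hv => hN v ?_
      rw [← mulVec_mulVec]
      exact ih (N *ᵥ v) (by rw [mulVec_mulVec, ← pow_succ, hv])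
  refine ext_of_mulVec_single fun i => ?_
  rw [← mulVec_mulVec, zero_mulVec]
  exact key _ (by rw [mulVec_mulVec, h, zero_mulVec])

theorem prod_X_sub_C_pow_count_eq_charpoly (M : Matrix n n ℂ) :
    ∏ a ∈ M.charpoly.roots.toFinset, (X - C a) ^ M.charpoly.roots.count a = M.charpoly := by
  conv_rhs => rw [(IsAlgClosed.splits M.charpoly).eq_prod_roots]
  rw [M.charpoly_monic.leadingCoeff, C_1, one_mul, Finset.prod_multiset_map_count]

/-- The factor of the characteristic polynomial coprime to `X - a`. -/
def cofactorPoly (M : Matrix n n ℂ) (a : ℂ) : ℂ[X] :=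
  ∏ b ∈ M.charpoly.roots.toFinset \ {a}, (X - C b) ^ M.charpoly.roots.count b

theorem pow_mul_aeval_cofactorPoly (M : Matrix n n ℂ) {a : ℂ}
    (ha : a ∈ M.charpoly.roots.toFinset) :
    (M - a • (1 : Matrix n n ℂ)) ^ M.charpoly.roots.count a * aeval M (M.cofactorPoly a) = 0 := by
  have h : (X - C a) ^ M.charpoly.roots.count a * M.cofactorPoly a = M.charpoly := by
    rw [cofactorPoly, Finset.sdiff_singleton_eq_erase,
      Finset.mul_prod_erase _ (fun b => (X - C b) ^ M.charpoly.roots.count b) ha,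
      M.prod_X_sub_C_pow_count_eq_charpoly]
  have := congrArg (aeval M) h
  simpa [aeval_self_charpoly, Algebra.algebraMap_eq_smul_one] using this

theorem eq_zero_of_aeval_cofactorPoly_mulVec (M : Matrix n n ℂ) (v : n → ℂ)
    (h : ∀ a ∈ M.charpoly.roots.toFinset, aeval M (M.cofactorPoly a) *ᵥ v = 0) : v = 0 := by
  rcases M.charpoly.roots.toFinset.eq_empty_or_nonempty with he | hne
  · have h1 : M.charpoly = 1 := by rw [← M.prod_X_sub_C_pow_count_eq_charpoly, he]; simp
    have h2 := aeval_self_charpoly M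
    rw [h1, map_one] at h2
    rw [← one_mulVec v, h2, zero_mulVec]
  · obtain ⟨c, hc⟩ := (exists_sum_eq_one_iff_pairwise_coprime
      (s := fun a => (X - C a : ℂ[X]) ^ M.charpoly.roots.count a) hne).2
      fun i j hij => (pairwise_coprime_X_sub_C Subtype.val_injective hij).pow
    have h2 := congrArg (aeval M) hc
    rw [map_one, map_sum] at h2
    rw [← one_mulVec v, ← h2, sum_mulVec]
    refine Finset.sum_eq_zero fun a ha => ?_
    rw [map_mul, ← mulVec_mulVec]
    exact (congrArg _ (h a ha)).trans (mulVec_zero _)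

theorem IsSpectrallyStable.exists_lyapunov {M : Matrix n n ℂ} (hM : M.IsSpectrallyStable) :
    ∃ P : Matrix n n ℂ, P.PosDef ∧ (-(P * M + Mᴴ * P)).PosSemidef := by
  have block : ∀ a ∈ M.charpoly.roots.toFinset, ∃ P : Matrix n n ℂ,
      (P - (aeval M (M.cofactorPoly a))ᴴ * aeval M (M.cofactorPoly a)).PosSemidef ∧
      (-(P * M + Mᴴ * P)).PosSemidef := by
    intro a ha
    have hroot : M.charpoly.IsRoot a := isRoot_of_mem_roots (Multiset.mem_toFinset.1 ha)
    have hdet : (M - a • (1 : Matrix n n ℂ)).det = 0 := by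
      rw [IsRoot, eval_charpoly, ← neg_sub, det_neg] at hroot
      simpa [smul_one_eq_diagonal] using hroot
    obtain ⟨hre, hss⟩ := hM a hdet
    obtain ⟨d, hd⟩ : ∃ d, M.charpoly.roots.count a = d + 1 :=
      Nat.exists_eq_succ_of_ne_zero (Multiset.count_ne_zero.2 (Multiset.mem_toFinset.1 ha))
    have hann := M.pow_mul_aeval_cofactorPoly ha
    rw [hd] at hann
    set q := aeval M (M.cofactorPoly a) with hq
    set N := M - a • (1 : Matrix n n ℂ) with hN
    have hcomm : q * M = a • q + N * q := by
      have : q * M = M * q := by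
        simpa using (congrArg (aeval M) (mul_comm (M.cofactorPoly a) X))
      rw [this, hN, Matrix.sub_mul]
      simp
    rcases hre.lt_or_eq with hlt | heq
    · have hU (k : ℕ) : N ^ k * q * M = a • (N ^ k * q) + N ^ (k + 1) * q := by
        rw [Matrix.mul_assoc, hcomm, Matrix.mul_add, Matrix.mul_smul, pow_succ, Matrix.mul_assoc]
      obtain ⟨P, hP, hL⟩ := exists_lyapunov_of_chain M (fun k => N ^ k * q) a hlt hU d
      exact ⟨P, by simpa using hP, by simpa [hann] using hL⟩
    · have hNq : N * q = 0 := mul_eq_zero_of_pow_mul_eq_zero (hss heq) d hann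
      rw [hNq, add_zero] at hcomm
      refine ⟨qᴴ * q, by simpa using PosSemidef.zero, ?_⟩
      have hstar : Mᴴ * qᴴ = star a • qᴴ := by
        rw [← conjTranspose_mul, hcomm, conjTranspose_smul]
      have h0 : a + star a = 0 := by
        simp [Complex.add_conj, heq]
      rw [Matrix.mul_assoc, hcomm, ← Matrix.mul_assoc, hstar, Matrix.mul_smul, Matrix.smul_mul,
        ← add_smul, h0]
      simpa using PosSemidef.zero
  choose! P hP hL using block
  refine ⟨∑ a ∈ M.charpoly.roots.toFinset, P a, ?_, ?_⟩
  · have hge := posSemidef_sum _ hP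
    have hpos : (∑ a ∈ M.charpoly.roots.toFinset,
        (aeval M (M.cofactorPoly a))ᴴ * aeval M (M.cofactorPoly a)).PosDef := by
      refine .of_dotProduct_mulVec_pos
        (posSemidef_sum _ fun a _ => posSemidef_conjTranspose_mul_self _).isHermitian
        fun x hx => ?_
      have hterm (a : ℂ) : star x ⬝ᵥ ((aeval M (M.cofactorPoly a))ᴴ *
          aeval M (M.cofactorPoly a)) *ᵥ x =
          star (aeval M (M.cofactorPoly a) *ᵥ x) ⬝ᵥ (aeval M (M.cofactorPoly a) *ᵥ x) := by
        rw [← mulVec_mulVec, dotProduct_mulVec, star_mulVec]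
      rw [sum_mulVec, dotProduct_sum]
      simp only [hterm]
      refine Finset.sum_pos' (fun a _ => dotProduct_star_self_nonneg _) ?_
      by_contra! hcon
      refine hx (M.eq_zero_of_aeval_cofactorPoly_mulVec x fun a ha => ?_)
      by_contra h0
      exact hcon a ha (dotProduct_star_self_pos_iff.2 h0)
    rw [Finset.sum_sub_distrib] at hge
    simpa using hpos.add_posSemidef hge
  · convert posSemidef_sum _ hL using 1
    rw [Finset.sum_neg_distrib, Finset.sum_add_distrib, Finset.sum_mul, Finset.mul_sum]

theorem isSpectrallyStable_of_lyapunov {M P : Matrix n n ℂ} (hP : P.PosDef)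
    (hL : (-(P * M + Mᴴ * P)).PosSemidef) : M.IsSpectrallyStable := by
  have key (μ : ℂ) (w : n → ℂ) (hw : M *ᵥ w = μ • w) :
      star w ⬝ᵥ (-(P * M + Mᴴ * P)) *ᵥ w = (-(2 * μ.re : ℝ) : ℂ) * (star w ⬝ᵥ P *ᵥ w) := by
    have h2 : ((2 * μ.re : ℝ) : ℂ) = μ + star μ := by
      simp [Complex.add_conj]
    have h3 : star w ⬝ᵥ (Mᴴ * P) *ᵥ w = star μ * (star w ⬝ᵥ P *ᵥ w) := by
      rw [← mulVec_mulVec, dotProduct_mulVec, ← star_mulVec, hw, star_smul, smul_dotProduct,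
        smul_eq_mul]
    rw [h2, neg_mulVec, dotProduct_neg, add_mulVec, dotProduct_add, h3, ← mulVec_mulVec, hw,
      mulVec_smul, dotProduct_smul, smul_eq_mul]
    ring
  intro μ hdet
  refine ⟨?_, fun hre v hv => ?_⟩
  · obtain ⟨w, hw0, hw⟩ := exists_mulVec_eq_zero_iff.2 hdet
    rw [sub_mulVec, smul_mulVec, one_mulVec, sub_eq_zero] at hw
    have h1 := hL.dotProduct_mulVec_nonneg w
    have h2 := hP.dotProduct_mulVec_pos hw0
    rw [key μ w hw] at h1
    rw [Complex.le_def] at h1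
    rw [Complex.lt_def] at h2
    have h3 := h1.1
    simp only [← Complex.ofReal_neg, Complex.re_ofReal_mul, Complex.zero_re] at h3 h2
    nlinarith [h2.1]
  · set w := (M - μ • (1 : Matrix n n ℂ)) *ᵥ v with hwv
    have hw : M *ᵥ w = μ • w := by
      rw [← mulVec_mulVec, ← hwv, sub_mulVec, smul_mulVec, one_mulVec, sub_eq_zero] at hv
      exact hv
    have h0 : star w ⬝ᵥ (-(P * M + Mᴴ * P)) *ᵥ w = 0 := by
      rw [key μ w hw, hre]; simp
    rw [hL.dotProduct_mulVec_zero_iff, neg_mulVec, neg_eq_zero, add_mulVec, ← mulVec_mulVec, hw,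
      mulVec_smul] at h0
    have hμ : star μ = -μ := by
      apply Complex.ext <;> simp [hre]
    have h4 : (M - μ • (1 : Matrix n n ℂ))ᴴ *ᵥ (P *ᵥ w) = 0 := by
      rw [conjTranspose_sub, conjTranspose_smul, conjTranspose_one, hμ, neg_smul, sub_neg_eq_add,
        add_mulVec, smul_mulVec, one_mulVec, mulVec_mulVec, add_comm]
      exact h0
    by_contra hne
    refine (hP.dotProduct_mulVec_pos hne).ne' ?_
    rw [hwv, star_mulVec, ← hwv, ← dotProduct_mulVec, h4, dotProduct_zero]

theorem isStable_iff_isSpectrallyStable (M : Matrix n n ℝ) :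
    M.IsStable ↔ (M.map Complex.ofReal).IsSpectrallyStable :=
  Iff.rfl

theorem PosDef.map_ofReal {S : Matrix n n ℝ} (hS : S.PosDef) :
    (S.map Complex.ofReal).PosDef := by
  rw [hS.posSemidef.map_ofReal.posDef_iff_isUnit]
  exact hS.isUnit.map (Complex.ofRealHom.mapMatrix (m := n))

/-- Lyapunov's criterion for (marginal) stability of a real matrix. -/
theorem isStable_iff_exists_lyapunov (M : Matrix n n ℝ) :
    M.IsStable ↔ ∃ Q : Matrix n n ℝ, Q.PosDef ∧ (-(Q * M + Mᵀ * Q)).PosSemidef := by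
  rw [isStable_iff_isSpectrallyStable]
  constructor
  · intro h
    obtain ⟨P, hP, hL⟩ := h.exists_lyapunov
    refine ⟨P.map Complex.re, hP.map_re, ?_⟩
    convert hL.map_re using 1
    ext i j
    simp [Matrix.mul_apply]
  · rintro ⟨Q, hQ, hL⟩
    refine isSpectrallyStable_of_lyapunov hQ.map_ofReal ?_
    convert hL.map_ofReal using 1
    ext i j
    simp [Matrix.mul_apply]

/-- The dissipative-Hamiltonian characterization of stable matrices. -/
theorem isStable_iff_exists_dh (M : Matrix n n ℝ) :
    M.IsStable ↔ ∃ J R Q : Matrix n n ℝ,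
      Jᵀ = -J ∧ R.PosSemidef ∧ Q.PosDef ∧ M = (J - R) * Q := by
  rw [isStable_iff_exists_lyapunov]
  constructor
  · rintro ⟨Q, hQ, hL⟩
    have hdet : IsUnit Q.det := (isUnit_iff_isUnit_det Q).1 hQ.isUnit
    have hQT : Q⁻¹ᵀ = Q⁻¹ := by
      simpa using hQ.isHermitian.inv.eq
    refine ⟨(1 / 2 : ℝ) • (M * Q⁻¹ - (M * Q⁻¹)ᵀ), (-(1 / 2) : ℝ) • (M * Q⁻¹ + (M * Q⁻¹)ᵀ), Q,
      ?_, ?_, hQ, ?_⟩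
    · rw [transpose_smul, transpose_sub, transpose_transpose, ← smul_neg, neg_sub]
    · convert (hL.conjTranspose_mul_mul_same Q⁻¹).smul (show (0 : ℝ) ≤ 1 / 2 by norm_num) using 1
      have h1 : Q⁻¹ * (Q * M) * Q⁻¹ = M * Q⁻¹ := by
        rw [nonsing_inv_mul_cancel_left _ _ hdet]
      have h2 : Q⁻¹ * (Mᵀ * Q) * Q⁻¹ = Q⁻¹ * Mᵀ := by
        rw [← Matrix.mul_assoc, mul_nonsing_inv_cancel_right _ _ hdet]
      rw [conjTranspose_eq_transpose_of_trivial, transpose_mul, hQT, Matrix.mul_neg,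
        Matrix.neg_mul, Matrix.mul_add, Matrix.add_mul, h1, h2]
      module
    · have h : (1 / 2 : ℝ) • (M * Q⁻¹ - (M * Q⁻¹)ᵀ) - (-(1 / 2) : ℝ) • (M * Q⁻¹ + (M * Q⁻¹)ᵀ) =
          M * Q⁻¹ := by module
      rw [h, nonsing_inv_mul_cancel_right _ _ hdet]
  · rintro ⟨J, R, Q, hJ, hR, hQ, rfl⟩
    refine ⟨Q, hQ, ?_⟩
    have hQT : Qᵀ = Q := by simpa using hQ.isHermitian.eq
    have hRT : Rᵀ = R := by simpa using hR.isHermitian.eq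
    convert (hR.conjTranspose_mul_mul_same Q).smul (show (0 : ℝ) ≤ 2 by norm_num) using 1
    rw [conjTranspose_eq_transpose_of_trivial, transpose_mul, transpose_sub, hJ, hRT, hQT, two_smul]
    noncomm_ring

end Matrix

/-- feasibility of the static-state feedback problem via DH matrices. -/
theorem ssf_feasible_iff_dh {n m : ℕ} (A : Matrix (Fin n) (Fin n) ℝ)
    (B : Matrix (Fin n) (Fin m) ℝ) (Bd : Matrix (Fin m) (Fin n) ℝ)
    (hBd : IsMoorePenrose B Bd) :
    (∃ K : Matrix (Fin m) (Fin n) ℝ, (A - B * K).IsStable) ↔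
      ∃ J R Q : Matrix (Fin n) (Fin n) ℝ,
        Jᵀ = -J ∧ R.PosSemidef ∧ Q.PosDef ∧
        (1 - B * Bd) * (A - (J - R) * Q) = 0 := by
  simp only [isStable_iff_exists_dh]
  constructor
  · rintro ⟨K, J, R, Q, hJ, hR, hQ, h⟩
    refine ⟨J, R, Q, hJ, hR, hQ, ?_⟩
    rw [← h, sub_sub_cancel, ← Matrix.mul_assoc, Matrix.sub_mul, Matrix.one_mul, hBd.1, sub_self,
      Matrix.zero_mul]
  · rintro ⟨J, R, Q, hJ, hR, hQ, h⟩
    refine ⟨Bd * (A - (J - R) * Q), J, R, Q, hJ, hR, hQ, ?_⟩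
    rw [Matrix.sub_mul, Matrix.one_mul, sub_eq_zero] at h
    rw [← Matrix.mul_assoc, ← h, sub_sub_cancel]
end
end

section
/- Let A ∈ ℝⁿˣⁿ, B ∈ ℝⁿˣᵐ, C ∈ ℝᵖˣⁿ. There exists K ∈ ℝᵐˣᵖ such that A − BKC is stable if and only if there exist J skew-symmetric, R ⪰ 0, Q ≻ 0 (all n×n) and Z ∈ ℝᵐˣᵖ such that B B†(A − (J−R)Q) C† C = A − (J−R)Q and K = B†(A − (J−R)Q)C† + Z − B†B Z C C†. -/
open Matrix

noncomputable section

namespace Matrix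

open scoped ComplexOrder

variable {n : Type*} [Fintype n]

theorem star_dotProduct_conjTranspose_mul_self_mulVec (T : Matrix n n ℂ) (x y : n → ℂ) :
    star x ⬝ᵥ ((Tᴴ * T) *ᵥ y) = star (T *ᵥ x) ⬝ᵥ (T *ᵥ y) := by
  rw [← mulVec_mulVec, dotProduct_mulVec, star_mulVec]

theorem re_star_dotProduct_self_nonneg (u : n → ℂ) : 0 ≤ (star u ⬝ᵥ u).re :=
  (Complex.nonneg_iff.mp (dotProduct_star_self_nonneg u)).1

theorem re_star_dotProduct_self_pos {u : n → ℂ} (hu : u ≠ 0) : 0 < (star u ⬝ᵥ u).re :=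
  (Complex.pos_iff.mp (dotProduct_star_self_pos_iff.mpr hu)).1

theorem mul_re_star_dotProduct_le (a : ℝ) (u v : n → ℂ) :
    a * (star u ⬝ᵥ v).re ≤ (star u ⬝ᵥ u).re + a ^ 2 / 4 * (star v ⬝ᵥ v).re := by
  have h := re_star_dotProduct_self_nonneg (u - ((a / 2 : ℝ) : ℂ) • v)
  have hvu : (star v ⬝ᵥ u).re = (star u ⬝ᵥ v).re := by
    rw [star_dotProduct, Complex.star_def, Complex.conj_re]
  simp only [star_sub, star_smul, sub_dotProduct, dotProduct_sub, smul_dotProduct,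
    dotProduct_smul, smul_eq_mul, Complex.star_def, Complex.conj_ofReal, Complex.sub_re,
    Complex.re_ofReal_mul, hvu] at h
  linarith

/-- A Hermitian form dominating `‖T x‖²` which is strictly dissipative for `M`, where the range
of `T` is annihilated by a power of `M - μ` and `Re μ < 0`. -/
theorem exists_isHermitian_strict_dissipative [DecidableEq n] (M : Matrix n n ℂ) (μ : ℂ)
    (hμ : μ.re < 0) (d : ℕ) (T : Matrix n n ℂ) (hT : Commute M T)
    (hd : (M - μ • 1) ^ d * T = 0) :
    ∃ L : Matrix n n ℂ, L.IsHermitian ∧ ∀ x : n → ℂ,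
      (star (T *ᵥ x) ⬝ᵥ (T *ᵥ x)).re ≤ (star x ⬝ᵥ (L *ᵥ x)).re ∧
      (star x ⬝ᵥ (L *ᵥ (M *ᵥ x))).re ≤ -(star (T *ᵥ x) ⬝ᵥ (T *ᵥ x)).re := by
  induction d generalizing T with
  | zero =>
    obtain rfl : T = 0 := by simpa using hd
    exact ⟨0, isHermitian_zero, by simp⟩
  | succ d ih =>
    have hN : Commute M (M - μ • 1) :=
      (Commute.refl M).sub_right ((Commute.one_right M).smul_right μ)
    obtain ⟨L, hL, hLx⟩ := ih ((M - μ • 1) * T) (hN.mul_right hT)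
      (by rw [← mul_assoc, ← pow_succ, hd])
    set a : ℝ := 1 + 2 / (-μ.re) with ha
    have ha1 : 1 ≤ a := by
      have : 0 < 2 / (-μ.re) := div_pos two_pos (neg_pos.mpr hμ)
      linarith
    have har : a * μ.re ≤ -2 := by
      have : a * μ.re = μ.re - 2 := by
        rw [ha]; field_simp [hμ.ne]; ring
      linarith
    refine ⟨(a : ℂ) • (Tᴴ * T) + ((a ^ 2 / 4 : ℝ) : ℂ) • L, ?_, fun x ↦ ?_⟩
    · refine IsHermitian.add ?_ ?_
      · simp [IsHermitian, conjTranspose_smul]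
      · rw [IsHermitian, conjTranspose_smul, hL.eq, Complex.star_def, Complex.conj_ofReal]
    obtain ⟨h1, h2⟩ := hLx x
    have hMx : T *ᵥ (M *ᵥ x) = μ • (T *ᵥ x) + ((M - μ • 1) * T) *ᵥ x := by
      rw [mulVec_mulVec, ← hT.eq, sub_mul, sub_mulVec, smul_mul_assoc, one_mul, smul_mulVec]
      abel
    have hq := re_star_dotProduct_self_nonneg (T *ᵥ x)
    have hv := re_star_dotProduct_self_nonneg (((M - μ • 1) * T) *ᵥ x)
    have hc := mul_re_star_dotProduct_le a (T *ᵥ x) (((M - μ • 1) * T) *ᵥ x)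
    have him : (star (T *ᵥ x) ⬝ᵥ (T *ᵥ x)).im = 0 :=
      (Complex.nonneg_iff.mp (dotProduct_star_self_nonneg (T *ᵥ x))).2.symm
    simp only [add_mulVec, smul_mulVec, dotProduct_add, dotProduct_smul,
      star_dotProduct_conjTranspose_mul_self_mulVec, hMx, smul_eq_mul, Complex.add_re,
      Complex.re_ofReal_mul]
    simp only [Complex.mul_re, him, mul_zero, sub_zero]
    have h4 : 0 ≤ a ^ 2 / 4 := by positivity
    constructor
    · nlinarith [mul_le_mul_of_nonneg_left h1 h4, mul_nonneg h4 hv]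
    · nlinarith [mul_le_mul_of_nonneg_left h2 h4]

theorem exists_isHermitian_dissipative [DecidableEq n] (M : Matrix n n ℂ) (μ : ℂ)
    (hμ : μ.re ≤ 0) (d : ℕ) (T : Matrix n n ℂ) (hT : Commute M T)
    (hd : (M - μ • 1) ^ d * T = 0) (h0 : μ.re = 0 → (M - μ • 1) * T = 0) :
    ∃ L : Matrix n n ℂ, L.IsHermitian ∧ ∀ x : n → ℂ,
      (star (T *ᵥ x) ⬝ᵥ (T *ᵥ x)).re ≤ (star x ⬝ᵥ (L *ᵥ x)).re ∧
      (star x ⬝ᵥ (L *ᵥ (M *ᵥ x))).re ≤ 0 := by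
  rcases hμ.lt_or_eq with h | h
  · obtain ⟨L, hL, hLx⟩ := exists_isHermitian_strict_dissipative M μ h d T hT hd
    exact ⟨L, hL, fun x ↦ ⟨(hLx x).1, (hLx x).2.trans
      (neg_nonpos.mpr (re_star_dotProduct_self_nonneg _))⟩⟩
  · refine ⟨Tᴴ * T, isHermitian_conjTranspose_mul_self T, fun x ↦ ?_⟩
    have hMx : T *ᵥ (M *ᵥ x) = μ • (T *ᵥ x) := by
      have := h0 h
      rw [sub_mul, smul_mul_assoc, one_mul, sub_eq_zero] at this
      rw [mulVec_mulVec, ← hT.eq, this, smul_mulVec]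
    have him : (star (T *ᵥ x) ⬝ᵥ (T *ᵥ x)).im = 0 :=
      (Complex.nonneg_iff.mp (dotProduct_star_self_nonneg (T *ᵥ x))).2.symm
    rw [star_dotProduct_conjTranspose_mul_self_mulVec,
      star_dotProduct_conjTranspose_mul_self_mulVec, hMx]
    simp [h, him]

theorem pow_mul_eq_zero_of_ker_sq [DecidableEq n] {N T : Matrix n n ℂ}
    (hN : ∀ v, (N * N) *ᵥ v = 0 → N *ᵥ v = 0) {d : ℕ} (hd : N ^ d * T = 0) : N * T = 0 := by
  induction d with
  | zero =>
    obtain rfl : T = 0 := by simpa using hd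
    simp
  | succ d ih =>
    cases d with
    | zero => simpa using hd
    | succ d =>
      refine ih (ext_of_mulVec_single fun i ↦ ?_)
      rw [zero_mulVec, pow_succ', mul_assoc, ← mulVec_mulVec]
      apply hN
      rw [pow_succ', pow_succ', mul_assoc, mul_assoc] at hd
      rw [mulVec_mulVec, mul_assoc, hd, zero_mulVec]

theorem exists_isHermitian_lyapunov [DecidableEq n] (M : Matrix n n ℂ)
    (hM : ∀ μ : ℂ, (M - μ • (1 : Matrix n n ℂ)).det = 0 → μ.re ≤ 0 ∧ (μ.re = 0 → ∀ v : n → ℂ,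
      ((M - μ • 1) * (M - μ • 1)) *ᵥ v = 0 → (M - μ • 1) *ᵥ v = 0)) :
    ∃ L : Matrix n n ℂ, L.IsHermitian ∧ ∀ x : n → ℂ,
      (x ≠ 0 → 0 < (star x ⬝ᵥ (L *ᵥ x)).re) ∧ (star x ⬝ᵥ (L *ᵥ (M *ᵥ x))).re ≤ 0 := by
  open Polynomial in
  rcases isEmpty_or_nonempty n with hn | hn
  · exact ⟨0, isHermitian_zero, fun x ↦ ⟨fun hx ↦ (hx (Subsingleton.elim _ _)).elim, by simp⟩⟩
  set t : Finset ℂ := M.charpoly.roots.toFinset with ht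
  set e : ℂ → ℕ := fun a ↦ M.charpoly.rootMultiplicity a
  set s : ℂ → ℂ[X] := fun a ↦ (X - C a) ^ e a
  have hprod : M.charpoly = ∏ a ∈ t, s a := by
    rw [← prod_multiset_root_eq_finset_root]
    exact (IsAlgClosed.splits _).eq_prod_roots_of_monic M.charpoly_monic
  have hne : t.Nonempty := by
    obtain ⟨z, hz⟩ := IsAlgClosed.exists_root M.charpoly (by
      rw [M.charpoly_degree_eq_dim]
      exact_mod_cast Fintype.card_ne_zero)
    exact ⟨z, by simpa [ht, M.charpoly_monic.ne_zero] using hz⟩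
  obtain ⟨r, hr⟩ := (exists_sum_eq_one_iff_pairwise_coprime (s := s) hne).mpr
    fun a b hab ↦ (pairwise_coprime_X_sub_C Subtype.val_injective hab).pow
  set T : ℂ → Matrix n n ℂ := fun a ↦ aeval M (∏ b ∈ t \ {a}, s b)
  have hs (a : ℂ) : aeval M (s a) = (M - a • 1) ^ e a := by
    simp [s, Algebra.algebraMap_eq_smul_one]
  have hT (a : ℂ) (ha : a ∈ t) : (M - a • 1) ^ e a * T a = 0 := by
    rw [← hs, ← map_mul, Finset.sdiff_singleton_eq_erase, Finset.mul_prod_erase t s ha, ← hprod,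
      aeval_self_charpoly]
  have hcomm (a : ℂ) : Commute M (T a) := by
    have := (Commute.all X (∏ b ∈ t \ {a}, s b)).map (aeval M)
    rwa [aeval_X] at this
  have hL (a : ℂ) (ha : a ∈ t) : ∃ L : Matrix n n ℂ, L.IsHermitian ∧ ∀ x : n → ℂ,
      (star (T a *ᵥ x) ⬝ᵥ (T a *ᵥ x)).re ≤ (star x ⬝ᵥ (L *ᵥ x)).re ∧
      (star x ⬝ᵥ (L *ᵥ (M *ᵥ x))).re ≤ 0 := by
    have hdet : (M - a • (1 : Matrix n n ℂ)).det = 0 := by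
      have h := (mem_roots'.mp (Multiset.mem_toFinset.mp ha)).2
      rw [IsRoot, eval_charpoly] at h
      rw [← neg_sub, det_neg, smul_one_eq_diagonal, ← scalar_apply, h, mul_zero]
    obtain ⟨h1, h2⟩ := hM a hdet
    exact exists_isHermitian_dissipative M a h1 (e a) (T a) (hcomm a) (hT a ha)
      fun h ↦ pow_mul_eq_zero_of_ker_sq (h2 h) (hT a ha)
  choose! L hLh hLx using hL
  refine ⟨∑ a ∈ t, L a, isSelfAdjoint_sum _ hLh, fun x ↦ ⟨fun hx ↦ ?_, ?_⟩⟩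
  · rw [sum_mulVec, dotProduct_sum, Complex.re_sum]
    refine Finset.sum_pos' (fun a ha ↦
      (re_star_dotProduct_self_nonneg _).trans (hLx a ha x).1) ?_
    by_contra! hcon
    refine hx ?_
    have hz (a : ℂ) (ha : a ∈ t) : T a *ᵥ x = 0 := by
      by_contra h
      linarith [re_star_dotProduct_self_pos h, (hLx a ha x).1, hcon a ha]
    have h1 := congrArg (fun q ↦ aeval M q *ᵥ x) hr
    simp only [map_sum, map_mul, map_one, one_mulVec, sum_mulVec] at h1
    rw [← h1]
    refine Finset.sum_eq_zero fun a ha ↦ ?_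
    rw [← mulVec_mulVec]
    exact (congrArg _ (hz a ha)).trans (mulVec_zero _)
  · rw [sum_mulVec, dotProduct_sum, Complex.re_sum]
    exact Finset.sum_nonpos fun a ha ↦ (hLx a ha x).2

theorem re_star_ofReal_dotProduct_mulVec (L : Matrix n n ℂ) (x y : n → ℝ) :
    (star (Complex.ofReal ∘ x) ⬝ᵥ (L *ᵥ (Complex.ofReal ∘ y))).re =
      x ⬝ᵥ (L.map Complex.re *ᵥ y) := by
  simp [dotProduct, mulVec]

theorem IsStable.exists_posDef [DecidableEq n] {M : Matrix n n ℝ} (hM : M.IsStable) :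
    ∃ Q : Matrix n n ℝ, Q.PosDef ∧ ∀ x : n → ℝ, x ⬝ᵥ (Q *ᵥ (M *ᵥ x)) ≤ 0 := by
  obtain ⟨L, hL, hLx⟩ := exists_isHermitian_lyapunov _ hM
  refine ⟨L.map Complex.re, .of_dotProduct_mulVec_pos ?_ fun x hx ↦ ?_, fun x ↦ ?_⟩
  · ext i j
    simp [← hL.apply i j]
  · rw [star_trivial, ← re_star_ofReal_dotProduct_mulVec]
    refine (hLx _).1 fun h ↦ hx (funext fun i ↦ ?_)
    simpa using congrFun h i
  · rw [← re_star_ofReal_dotProduct_mulVec]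
    have h : Complex.ofReal ∘ (M *ᵥ x) = M.map Complex.ofReal *ᵥ (Complex.ofReal ∘ x) := by
      ext i
      exact RingHom.map_mulVec Complex.ofRealHom M x i
    rw [h]
    exact (hLx _).2

theorem IsStable.exists_dissipative_hamiltonian [DecidableEq n] {M : Matrix n n ℝ}
    (hM : M.IsStable) :
    ∃ J R Q : Matrix n n ℝ, Jᵀ = -J ∧ R.PosSemidef ∧ Q.PosDef ∧ M = (J - R) * Q := by
  obtain ⟨Q, hQ, hQx⟩ := hM.exists_posDef
  have hu : IsUnit Q.det := (isUnit_iff_isUnit_det Q).mp hQ.isUnit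
  set S := M * Q⁻¹
  refine ⟨(2⁻¹ : ℝ) • (S - Sᵀ), -((2⁻¹ : ℝ) • (S + Sᵀ)), Q, ?_,
    .of_dotProduct_mulVec_nonneg ?_ fun x ↦ ?_, hQ, ?_⟩
  · simp [← smul_neg]
  · simp [IsHermitian, conjTranspose_eq_transpose_of_trivial, add_comm]
  · have hQt : Qᵀ = Q := hQ.isHermitian
    have hS : x ⬝ᵥ (S *ᵥ x) ≤ 0 := by
      have hx : Q *ᵥ (Q⁻¹ *ᵥ x) = x := by rw [mulVec_mulVec, mul_nonsing_inv _ hu, one_mulVec]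
      have := hQx (Q⁻¹ *ᵥ x)
      rwa [dotProduct_mulVec, ← mulVec_transpose, hQt, hx, mulVec_mulVec] at this
    have hSt : x ⬝ᵥ (Sᵀ *ᵥ x) = x ⬝ᵥ (S *ᵥ x) := by
      rw [mulVec_transpose, dotProduct_comm, ← dotProduct_mulVec]
    rw [star_trivial, neg_mulVec, dotProduct_neg, smul_mulVec, dotProduct_smul, add_mulVec,
      dotProduct_add, hSt, smul_eq_mul]
    linarith
  · have : (2⁻¹ : ℝ) • (S - Sᵀ) - -((2⁻¹ : ℝ) • (S + Sᵀ)) = S := by module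
    rw [this, nonsing_inv_mul_cancel_right _ _ hu]

theorem PosSemidef.map_ofReal_s10 {R : Matrix n n ℝ} (hR : R.PosSemidef) :
    (R.map Complex.ofReal).PosSemidef := by
  classical
  open scoped MatrixOrder in
  obtain ⟨G, rfl⟩ := CStarAlgebra.nonneg_iff_eq_star_mul_self.mp hR.nonneg
  have h : (star G * G).map Complex.ofReal =
      (G.map Complex.ofReal)ᴴ * G.map Complex.ofReal := by
    ext i j
    simp [mul_apply]
  rw [h]
  exact posSemidef_conjTranspose_mul_self _

theorem PosDef.map_ofReal_s10 {Q : Matrix n n ℝ} (hQ : Q.PosDef) :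
    (Q.map Complex.ofReal).PosDef := by
  classical
  rw [hQ.posSemidef.map_ofReal_s10.posDef_iff_det_ne_zero]
  have := Complex.ofRealHom.map_det Q
  simp only [RingHom.mapMatrix_apply] at this
  rw [show Q.map Complex.ofReal = Q.map Complex.ofRealHom from rfl, ← this]
  exact Complex.ofReal_ne_zero.mpr hQ.det_pos.ne'

theorem isStable_dissipative_hamiltonian [DecidableEq n] {J R Q : Matrix n n ℝ} (hJ : Jᵀ = -J)
    (hR : R.PosSemidef) (hQ : Q.PosDef) : ((J - R) * Q).IsStable := by
  have hmap : ((J - R) * Q).map Complex.ofReal =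
      (J.map Complex.ofReal - R.map Complex.ofReal) * Q.map Complex.ofReal := by
    ext i j
    simp [mul_apply]
  have hJ' : (J.map Complex.ofReal)ᴴ = -J.map Complex.ofReal := by
    ext i j
    simpa using congrArg Complex.ofReal (congrFun₂ hJ i j)
  unfold IsStable
  rw [hmap]
  have hR' := hR.map_ofReal_s10
  have hQ' := hQ.map_ofReal_s10
  generalize J.map Complex.ofReal = J at *
  generalize R.map Complex.ofReal = R at *
  generalize Q.map Complex.ofReal = Q at *
  have hQQ (x y : n → ℂ) : star (Q *ᵥ x) ⬝ᵥ y = star x ⬝ᵥ (Q *ᵥ y) := by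
    rw [star_mulVec, ← dotProduct_mulVec, hQ'.isHermitian.eq]
  have hJJ (x y : n → ℂ) : star (J *ᵥ x) ⬝ᵥ y = -(star x ⬝ᵥ (J *ᵥ y)) := by
    rw [star_mulVec, ← dotProduct_mulVec, hJ', neg_mulVec, dotProduct_neg]
  have hRR (x y : n → ℂ) : star (R *ᵥ x) ⬝ᵥ y = star x ⬝ᵥ (R *ᵥ y) := by
    rw [star_mulVec, ← dotProduct_mulVec, hR'.isHermitian.eq]
  have hJre (x : n → ℂ) : (star x ⬝ᵥ (J *ᵥ x)).re = 0 := by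
    have h := congrArg Complex.re (hJJ x x)
    rw [star_dotProduct, Complex.star_def, Complex.conj_re, Complex.neg_re] at h
    linarith
  have energy (μ : ℂ) (v : n → ℂ) (hv : ((J - R) * Q - μ • 1) *ᵥ v = 0) :
      J *ᵥ (Q *ᵥ v) - R *ᵥ (Q *ᵥ v) = μ • v ∧
      μ.re * (star v ⬝ᵥ (Q *ᵥ v)).re = -(star (Q *ᵥ v) ⬝ᵥ (R *ᵥ (Q *ᵥ v))).re := by
    have h1 : J *ᵥ (Q *ᵥ v) - R *ᵥ (Q *ᵥ v) = μ • v := by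
      rwa [sub_mulVec, smul_mulVec, one_mulVec, sub_eq_zero, ← mulVec_mulVec, sub_mulVec] at hv
    refine ⟨h1, ?_⟩
    have h2 := congrArg (fun w ↦ (star (Q *ᵥ v) ⬝ᵥ w).re) h1
    simp only [dotProduct_sub, Complex.sub_re, hJre, dotProduct_smul, smul_eq_mul,
      Complex.mul_re] at h2
    rw [hQQ v v] at h2
    have him : (star v ⬝ᵥ (Q *ᵥ v)).im = 0 :=
      (Complex.nonneg_iff.mp (hQ'.posSemidef.dotProduct_mulVec_nonneg v)).2.symm
    rw [him] at h2
    linarith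
  intro μ hμ
  constructor
  · obtain ⟨v, hv0, hv⟩ := exists_mulVec_eq_zero_iff.mpr hμ
    have h1 := (energy μ v hv).2
    have h2 : 0 < (star v ⬝ᵥ (Q *ᵥ v)).re := hQ'.re_dotProduct_pos hv0
    have h3 : 0 ≤ (star (Q *ᵥ v) ⬝ᵥ (R *ᵥ (Q *ᵥ v))).re := hR'.re_dotProduct_nonneg _
    by_contra! h
    linarith [mul_pos h h2]
  · intro h0 v hv
    rw [← mulVec_mulVec] at hv
    obtain ⟨u, hu⟩ : ∃ u, u = ((J - R) * Q - μ • 1) *ᵥ v := ⟨_, rfl⟩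
    rw [← hu] at hv ⊢
    obtain ⟨h1, h2⟩ := energy μ u hv
    have hRu : R *ᵥ (Q *ᵥ u) = 0 := by
      rw [← hR'.dotProduct_mulVec_zero_iff]
      have h3 := Complex.nonneg_iff.mp (hR'.dotProduct_mulVec_nonneg (Q *ᵥ u))
      refine Complex.ext ?_ h3.2.symm
      rw [h0, zero_mul] at h2
      simpa using h2
    rw [hRu, sub_zero] at h1
    have hμ' : star μ = -μ := by
      apply Complex.ext <;> simp [h0]
    by_contra hu0
    refine (hQ'.dotProduct_mulVec_pos hu0).ne' ?_
    have h3 : u = J *ᵥ (Q *ᵥ v) - R *ᵥ (Q *ᵥ v) - μ • v := by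
      rw [hu, sub_mulVec, smul_mulVec, one_mulVec, ← mulVec_mulVec, sub_mulVec]
    calc star u ⬝ᵥ (Q *ᵥ u) = star (Q *ᵥ u) ⬝ᵥ u := (hQQ u u).symm
      _ = star (Q *ᵥ u) ⬝ᵥ (J *ᵥ (Q *ᵥ v) - R *ᵥ (Q *ᵥ v) - μ • v) := by rw [← h3]
      _ = 0 := by
        rw [dotProduct_sub, dotProduct_sub, ← hRR, hRu, star_zero, zero_dotProduct,
          ← neg_eq_iff_eq_neg.mpr (hJJ (Q *ᵥ u) (Q *ᵥ v)), h1, star_smul, hμ', smul_dotProduct,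
          dotProduct_smul, ← hQQ u v]
        simp

theorem isStable_iff_exists_dissipative_hamiltonian [DecidableEq n] {M : Matrix n n ℝ} :
    M.IsStable ↔
      ∃ J R Q : Matrix n n ℝ, Jᵀ = -J ∧ R.PosSemidef ∧ Q.PosDef ∧ M = (J - R) * Q := by
  refine ⟨fun h ↦ h.exists_dissipative_hamiltonian, ?_⟩
  rintro ⟨J, R, Q, hJ, hR, hQ, rfl⟩
  exact isStable_dissipative_hamiltonian hJ hR hQ

end Matrix

/-- DH characterization of all stabilizing static-output feedbacks. -/
theorem sof_characterization {n m p : ℕ} (A : Matrix (Fin n) (Fin n) ℝ)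
    (B : Matrix (Fin n) (Fin m) ℝ) (Bd : Matrix (Fin m) (Fin n) ℝ)
    (C : Matrix (Fin p) (Fin n) ℝ) (Cd : Matrix (Fin n) (Fin p) ℝ)
    (hBd : IsMoorePenrose B Bd) (hCd : IsMoorePenrose C Cd)
    (K : Matrix (Fin m) (Fin p) ℝ) :
    (A - B * K * C).IsStable ↔
      ∃ (J R Q : Matrix (Fin n) (Fin n) ℝ) (Z : Matrix (Fin m) (Fin p) ℝ),
        Jᵀ = -J ∧ R.PosSemidef ∧ Q.PosDef ∧
        B * Bd * (A - (J - R) * Q) * Cd * C = A - (J - R) * Q ∧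
        K = Bd * (A - (J - R) * Q) * Cd + Z - Bd * B * Z * C * Cd := by
  rw [isStable_iff_exists_dissipative_hamiltonian]
  constructor
  · rintro ⟨J, R, Q, hJ, hR, hQ, h⟩
    have hX : A - (J - R) * Q = B * K * C := by rw [← h, sub_sub_cancel]
    refine ⟨J, R, Q, K, hJ, hR, hQ, ?_, ?_⟩
    · rw [hX]
      calc B * Bd * (B * K * C) * Cd * C = (B * Bd * B) * K * (C * Cd * C) := by
            simp only [Matrix.mul_assoc]
        _ = B * K * C := by rw [hBd.1, hCd.1]
    · rw [hX]
      simp only [Matrix.mul_assoc, add_sub_cancel_left]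
  · rintro ⟨J, R, Q, Z, hJ, hR, hQ, hX, hK⟩
    refine ⟨J, R, Q, hJ, hR, hQ, ?_⟩
    have hBKC : B * K * C = A - (J - R) * Q := by
      generalize A - (J - R) * Q = X at *
      calc B * K * C
          = B * Bd * X * Cd * C + B * Z * C - (B * Bd * B) * Z * (C * Cd * C) := by
            rw [hK]
            simp only [Matrix.mul_add, Matrix.mul_sub, Matrix.add_mul, Matrix.sub_mul,
              Matrix.mul_assoc]
        _ = X := by rw [hX, hBd.1, hCd.1, add_sub_cancel_right]
    rw [hBKC, sub_sub_cancel]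
end
end

section
/- Let A ∈ ℝⁿˣⁿ, B ∈ ℝⁿˣᵐ, C ∈ ℝᵖˣⁿ, and K ∈ ℝᵐˣᵖ with A − BKC stable. Then there exist J skew-symmetric, R ⪰ 0, Q ≻ 0 such that (Iₙ − B B†)(A − (J−R)Q) = 0 and (A − (J−R)Q)(C†C − Iₙ) = 0. -/
open Matrix

noncomputable section

open scoped ComplexOrder

lemma re_star_dotProduct_mulVec_ofReal {n : Type*} [Fintype n] (X : Matrix n n ℂ) (x : n → ℝ) :
    (star (fun i => (x i : ℂ)) ⬝ᵥ (X *ᵥ fun i => (x i : ℂ))).re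
      = star x ⬝ᵥ (X.map Complex.re *ᵥ x) := by
  simp [dotProduct, mulVec]

lemma Matrix.IsHermitian.map_re_s12 {n : Type*} {X : Matrix n n ℂ} (hX : X.IsHermitian) :
    (X.map Complex.re).IsHermitian := by
  ext i j
  simpa using congrArg Complex.re (congrFun (congrFun hX i) j)

lemma Matrix.PosSemidef.map_re_s12 {n : Type*} [Fintype n] {X : Matrix n n ℂ} (hX : X.PosSemidef) :
    (X.map Complex.re).PosSemidef := by
  refine .of_dotProduct_mulVec_nonneg hX.1.map_re_s12 fun x => ?_
  rw [← re_star_dotProduct_mulVec_ofReal]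
  exact (Complex.le_def.1 (hX.dotProduct_mulVec_nonneg _)).1

lemma Matrix.PosDef.map_re_s12 {n : Type*} [Fintype n] {X : Matrix n n ℂ} (hX : X.PosDef) :
    (X.map Complex.re).PosDef := by
  refine .of_dotProduct_mulVec_pos hX.1.map_re_s12 fun x hx => ?_
  rw [← re_star_dotProduct_mulVec_ofReal]
  refine (Complex.lt_def.1 (hX.dotProduct_mulVec_pos fun h => hx ?_)).1
  funext i
  simpa using congrFun h i

section Lyapunov

variable {n : Type*} [Fintype n] [DecidableEq n]

open Polynomial in
/-- Coprime factors of the characteristic polynomial yield matrices `E μ`, annihilated by powers of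
`T - μ`, that jointly generate the identity. -/
lemma exists_generalized_spectral_partition (T : Matrix n n ℂ) :
    ∃ (s : Finset ℂ) (E F : ℂ → Matrix n n ℂ),
      (∀ μ ∈ s, (T - μ • (1 : Matrix n n ℂ)).det = 0) ∧
      (∀ μ, Commute (E μ) T) ∧
      (∀ μ ∈ s, ∃ d : ℕ, E μ * (T - μ • (1 : Matrix n n ℂ)) ^ d = 0) ∧
      ∑ μ ∈ s, F μ * E μ = 1 := by
  classical
  set s := T.charpoly.roots.toFinset
  set f : ℂ → ℂ[X] := fun μ => (X - C μ) ^ T.charpoly.roots.count μ with hf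
  have hprod : ∏ μ ∈ s, f μ = T.charpoly := by
    have h := (IsAlgClosed.splits T.charpoly).eq_prod_roots_of_monic T.charpoly_monic
    rw [Finset.prod_multiset_map_count] at h
    exact h.symm
  have hsum : ∃ g : ℂ → ℂ[X], aeval T (∑ μ ∈ s, g μ * ∏ ν ∈ s \ {μ}, f ν) = 1 := by
    rcases s.eq_empty_or_nonempty with h | h
    · refine ⟨0, ?_⟩
      have h0 := T.aeval_self_charpoly
      rw [← hprod, h, Finset.prod_empty, map_one] at h0
      rw [h, Finset.sum_empty, map_zero, h0]
    · obtain ⟨g, hg⟩ := (exists_sum_eq_one_iff_pairwise_coprime (s := f) h).2 (by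
        intro i j hij
        exact (pairwise_coprime_X_sub_C (s := fun x : s => (x : ℂ)) Subtype.val_injective hij).pow)
      exact ⟨g, by rw [hg, map_one]⟩
  obtain ⟨g, hg⟩ := hsum
  refine ⟨s, fun μ => aeval T (∏ ν ∈ s \ {μ}, f ν), fun μ => aeval T (g μ), ?_, ?_, ?_, ?_⟩
  · intro μ hμ
    have hroot : T.charpoly.eval μ = 0 :=
      (mem_roots T.charpoly_monic.ne_zero).1 (Multiset.mem_toFinset.1 hμ)
    rw [Matrix.eval_charpoly] at hroot
    rw [← neg_sub, Matrix.det_neg, Matrix.smul_one_eq_diagonal, ← Matrix.scalar_apply, hroot,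
      mul_zero]
  · intro μ
    simpa using (Commute.all (∏ ν ∈ s \ {μ}, f ν) X).map (aeval T)
  · intro μ hμ
    refine ⟨T.charpoly.roots.count μ, ?_⟩
    have hfac : aeval T (f μ) = (T - μ • (1 : Matrix n n ℂ)) ^ T.charpoly.roots.count μ := by
      simp [hf, Algebra.algebraMap_eq_smul_one]
    rw [← hfac, ← map_mul, mul_comm, Finset.sdiff_singleton_eq_erase, Finset.mul_prod_erase _ _ hμ,
      hprod, T.aeval_self_charpoly]
  · simpa using hg

/-- On a generalized eigenspace of an eigenvalue with negative real part there is a strict Lyapunov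
form dominating the standard one. -/
lemma exists_lyapunov_of_mul_pow_eq_zero {T : Matrix n n ℂ} {μ : ℂ} (hμ : μ.re < 0) (d : ℕ) :
    ∀ E : Matrix n n ℂ, E * (T - μ • (1 : Matrix n n ℂ)) ^ d = 0 →
      ∃ Q : Matrix n n ℂ, (Q - Eᴴ * E).PosSemidef ∧
        (-(Tᴴ * Q + Q * T) - (-μ.re : ℂ) • (Eᴴ * E)).PosSemidef := by
  induction d with
  | zero =>
    intro E hE
    obtain rfl : E = 0 := by simpa using hE
    exact ⟨0, by simpa using PosSemidef.zero, by simpa using PosSemidef.zero⟩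
  | succ d ih =>
    intro E hE
    set D := E * (T - μ • (1 : Matrix n n ℂ)) with hD
    obtain ⟨Q, hQ, hTQ⟩ := ih D (by rw [hD, mul_assoc, ← pow_succ', hE])
    have hET : E * T = D + μ • E := by simp [hD, mul_sub]
    have hTE : Tᴴ * Eᴴ = Dᴴ + star μ • Eᴴ := by
      rw [← conjTranspose_mul, hET, conjTranspose_add, conjTranspose_smul]
    set a : ℝ := -μ.re with ha
    have ha0 : 0 < a := by linarith
    have hac : (a : ℂ) ≠ 0 := by exact_mod_cast ha0.ne'
    set c : ℝ := a⁻¹ ^ 2 with hc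
    have hc0 : (0 : ℂ) ≤ (c : ℂ) := by exact_mod_cast sq_nonneg a⁻¹
    have hia : (0 : ℂ) ≤ (a⁻¹ : ℝ) := by exact_mod_cast (inv_pos.2 ha0).le
    refine ⟨Eᴴ * E + (c : ℂ) • Q, ?_, ?_⟩
    · have hQ' : Q.PosSemidef := by
        simpa using hQ.add (posSemidef_conjTranspose_mul_self D)
      simpa using hQ'.smul hc0
    · have key : -(Tᴴ * (Eᴴ * E + (c : ℂ) • Q) + (Eᴴ * E + (c : ℂ) • Q) * T)
          - (-μ.re : ℂ) • (Eᴴ * E)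
          = (c : ℂ) • (-(Tᴴ * Q + Q * T) - (-μ.re : ℂ) • (Dᴴ * D))
            + ((a⁻¹ : ℝ) : ℂ) • (((a : ℂ) • E - D)ᴴ * ((a : ℂ) • E - D)) := by
        have e1 : Tᴴ * (Eᴴ * E) = Dᴴ * E + star μ • (Eᴴ * E) := by
          rw [← mul_assoc, hTE, add_mul, smul_mul_assoc]
        have e2 : Eᴴ * E * T = Eᴴ * D + μ • (Eᴴ * E) := by
          rw [mul_assoc, hET, mul_add, mul_smul_comm]
        have e3 : (-μ.re : ℂ) = (a : ℂ) := by simp [ha]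
        have e4 : star μ = -2 * (a : ℂ) - μ := by
          apply Complex.ext <;> simp [ha]; ring
        simp only [mul_add, add_mul, e1, e2, e3, e4, conjTranspose_sub, conjTranspose_smul,
          sub_mul, mul_sub, smul_mul_assoc, mul_smul_comm, Complex.star_def, Complex.conj_ofReal]
        have h1 : (c : ℂ) * (a : ℂ) = ((a⁻¹ : ℝ) : ℂ) := by
          rw [hc]; push_cast; field_simp
        have h2 : ((a⁻¹ : ℝ) : ℂ) * (a : ℂ) = 1 := by push_cast; field_simp
        simp only [smul_sub, smul_smul, smul_add, smul_neg, h1, h2, one_smul, ← mul_assoc, one_mul]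
        module
      rw [key]
      exact (hTQ.smul hc0).add ((posSemidef_conjTranspose_mul_self _).smul hia)

lemma mul_eq_zero_of_ker_sq_le {N E : Matrix n n ℂ} (hNE : Commute E N)
    (hker : ∀ v, (N * N) *ᵥ v = 0 → N *ᵥ v = 0) {d : ℕ} (hd : E * N ^ d = 0) : E * N = 0 := by
  have hmat : ∀ X : Matrix n n ℂ, N * (N * X) = 0 → N * X = 0 := by
    intro X hX
    refine Matrix.ext_of_mulVec_single fun i => ?_
    rw [zero_mulVec, ← mulVec_mulVec]
    apply hker
    rw [mulVec_mulVec, mul_assoc, hX, zero_mulVec]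
  have hpow : ∀ k : ℕ, N ^ k * E = 0 → N * E = 0 := by
    intro k
    induction k with
    | zero => intro h; simp_all
    | succ k ih =>
      intro h
      cases k with
      | zero => simpa using h
      | succ k =>
        apply ih
        rw [pow_succ', mul_assoc]
        apply hmat
        simpa only [pow_succ', mul_assoc] using h
  rw [hNE.eq]
  exact hpow d (by rw [← (hNE.pow_right d).eq, hd])

lemma exists_posDef_lyapunov {T : Matrix n n ℂ}
    (hT : ∀ μ : ℂ, (T - μ • (1 : Matrix n n ℂ)).det = 0 → μ.re ≤ 0 ∧ (μ.re = 0 → ∀ v : n → ℂ,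
      ((T - μ • 1) * (T - μ • 1)) *ᵥ v = 0 → (T - μ • 1) *ᵥ v = 0)) :
    ∃ Q : Matrix n n ℂ, Q.PosDef ∧ (-(Tᴴ * Q + Q * T)).PosSemidef := by
  obtain ⟨s, E, F, hdet, hcomm, hnil, hsum⟩ := exists_generalized_spectral_partition T
  have hloc : ∀ μ ∈ s, ∃ Q : Matrix n n ℂ, (Q - (E μ)ᴴ * E μ).PosSemidef ∧
      (-(Tᴴ * Q + Q * T)).PosSemidef := by
    intro μ hμ
    obtain ⟨hre, hss⟩ := hT μ (hdet μ hμ)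
    obtain ⟨d, hd⟩ := hnil μ hμ
    rcases hre.lt_or_eq with hlt | heq
    · obtain ⟨Q, hQ, hTQ⟩ := exists_lyapunov_of_mul_pow_eq_zero hlt d (E μ) hd
      refine ⟨Q, hQ, ?_⟩
      have ha : (0 : ℂ) ≤ (-μ.re : ℂ) := by exact_mod_cast (neg_pos.2 hlt).le
      simpa using hTQ.add ((posSemidef_conjTranspose_mul_self (E μ)).smul ha)
    · have h0 := mul_eq_zero_of_ker_sq_le
        ((hcomm μ).sub_right ((Commute.one_right (E μ)).smul_right μ)) (hss heq) hd
      have hET : E μ * T = μ • E μ := by simpa [mul_sub, sub_eq_zero] using h0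
      have hTE : Tᴴ * (E μ)ᴴ = star μ • (E μ)ᴴ := by
        rw [← conjTranspose_mul, hET, conjTranspose_smul]
      refine ⟨(E μ)ᴴ * E μ, by simpa using PosSemidef.zero, ?_⟩
      have hμ0 : star μ + μ = 0 := by apply Complex.ext <;> simp [heq]
      rw [← mul_assoc, hTE, mul_assoc, hET, smul_mul_assoc, mul_smul_comm, ← add_smul, hμ0,
        zero_smul, neg_zero]
      exact PosSemidef.zero
  choose! Q hQ hTQ using hloc
  refine ⟨∑ μ ∈ s, Q μ, ?_, ?_⟩
  · have hE : (∑ μ ∈ s, (E μ)ᴴ * E μ).PosDef := by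
      refine .of_dotProduct_mulVec_pos
        (posSemidef_sum s fun μ _ => posSemidef_conjTranspose_mul_self (E μ)).1 fun x hx => ?_
      have hex : ∃ μ ∈ s, E μ *ᵥ x ≠ 0 := by
        by_contra! h
        apply hx
        rw [← one_mulVec x, ← hsum, sum_mulVec]
        refine Finset.sum_eq_zero fun μ hμ => ?_
        rw [← mulVec_mulVec, h μ hμ, mulVec_zero]
      obtain ⟨μ, hμ, hne⟩ := hex
      rw [sum_mulVec, dotProduct_sum]
      refine Finset.sum_pos' (fun ν _ =>
        (posSemidef_conjTranspose_mul_self (E ν)).dotProduct_mulVec_nonneg x) ⟨μ, hμ, ?_⟩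
      rw [← mulVec_mulVec, dotProduct_mulVec, ← star_mulVec]
      exact dotProduct_star_self_pos_iff.2 hne
    simpa using hE.add_posSemidef (posSemidef_sum s hQ)
  · simpa [Finset.mul_sum, Finset.sum_mul, Finset.sum_add_distrib] using posSemidef_sum s hTQ

/-- A stable real matrix admits a real Lyapunov form. -/
lemma Matrix.IsStable.exists_posDef_lyapunov {M : Matrix n n ℝ} (hM : M.IsStable) :
    ∃ Q : Matrix n n ℝ, Q.PosDef ∧ (-(Mᵀ * Q + Q * M)).PosSemidef := by
  obtain ⟨P, hP, hMP⟩ := _root_.exists_posDef_lyapunov (T := M.map Complex.ofReal) hM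
  refine ⟨P.map Complex.re, hP.map_re_s12, ?_⟩
  convert hMP.map_re_s12 using 1
  ext i j
  simp [mul_apply]

/-- A stable real matrix has a dissipative Hamiltonian factorization. -/
lemma Matrix.IsStable.exists_dissipativeHamiltonian {M : Matrix n n ℝ} (hM : M.IsStable) :
    ∃ J R Q : Matrix n n ℝ, Jᵀ = -J ∧ R.PosSemidef ∧ Q.PosDef ∧ (J - R) * Q = M := by
  obtain ⟨Q, hQ, hMQ⟩ := hM.exists_posDef_lyapunov
  have hdet : IsUnit Q.det := (isUnit_iff_isUnit_det Q).1 hQ.isUnit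
  have hQt : (Q⁻¹)ᵀ = Q⁻¹ := by simpa using hQ.inv.isHermitian.eq
  refine ⟨(1 / 2 : ℝ) • (M * Q⁻¹ - Q⁻¹ * Mᵀ), (1 / 2 : ℝ) • -(M * Q⁻¹ + Q⁻¹ * Mᵀ), Q,
    ?_, ?_, hQ, ?_⟩
  · simp only [transpose_smul, transpose_sub, transpose_mul, transpose_transpose, hQt]
    module
  · have hR : Q⁻¹ * -(Mᵀ * Q + Q * M) * Q⁻¹ = -(M * Q⁻¹ + Q⁻¹ * Mᵀ) := by
      rw [mul_neg, neg_mul, mul_add, add_mul, nonsing_inv_mul_cancel_left _ _ hdet,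
        ← mul_assoc Q⁻¹, mul_nonsing_inv_cancel_right _ _ hdet, add_comm]
    have hpsd := hMQ.mul_mul_conjTranspose_same Q⁻¹
    rw [hQ.inv.isHermitian.eq, hR] at hpsd
    exact hpsd.smul (by norm_num)
  · have hJR : (1 / 2 : ℝ) • (M * Q⁻¹ - Q⁻¹ * Mᵀ) - (1 / 2 : ℝ) • -(M * Q⁻¹ + Q⁻¹ * Mᵀ)
        = M * Q⁻¹ := by module
    rw [hJR, nonsing_inv_mul_cancel_right _ _ hdet]

end Lyapunov

/-- if A − BKC is stable then the two-sided DH compatibility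
conditions are satisfiable. -/
theorem sof_stable_imp_dh_conditions {n m p : ℕ} (A : Matrix (Fin n) (Fin n) ℝ)
    (B : Matrix (Fin n) (Fin m) ℝ) (Bd : Matrix (Fin m) (Fin n) ℝ)
    (C : Matrix (Fin p) (Fin n) ℝ) (Cd : Matrix (Fin n) (Fin p) ℝ)
    (hBd : IsMoorePenrose B Bd) (hCd : IsMoorePenrose C Cd)
    (K : Matrix (Fin m) (Fin p) ℝ) (hK : (A - B * K * C).IsStable) :
    ∃ J R Q : Matrix (Fin n) (Fin n) ℝ,
      Jᵀ = -J ∧ R.PosSemidef ∧ Q.PosDef ∧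
      (1 - B * Bd) * (A - (J - R) * Q) = 0 ∧
      (A - (J - R) * Q) * (Cd * C - 1) = 0 := by
  obtain ⟨J, R, Q, hJ, hR, hQ, hM⟩ := hK.exists_dissipativeHamiltonian
  refine ⟨J, R, Q, hJ, hR, hQ, ?_, ?_⟩
  · rw [hM, sub_sub_cancel, sub_mul, Matrix.one_mul, Matrix.mul_assoc B K,
      ← Matrix.mul_assoc _ B, hBd.1, sub_self]
  · rw [hM, sub_sub_cancel, mul_sub, Matrix.mul_one, Matrix.mul_assoc _ C,
      ← Matrix.mul_assoc C, hCd.1, sub_self]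
end
end

section
/- Let A ∈ ℝⁿˣⁿ, B ∈ ℝⁿˣᵐ, C ∈ ℝᵖˣⁿ, and suppose (J, R, Q) with J skew-symmetric, R ⪰ 0, Q ≻ 0 satisfies (Iₙ − BB†)(A − (J−R)Q) = 0 and (A − (J−R)Q)(C†C − Iₙ) = 0. Then for all Y, Z ∈ ℝᵐˣᵖ, the matrix K = B†(A − (J−R)Q)C† + (I_m − B†B)Y + Z(I_p − CC†) satisfies B K C = A − (J−R)Q, hence A − BKC = (J−R)Q is stable. -/
open Matrix

noncomputable section

section

open scoped ComplexOrder MatrixOrder Matrix.Norms.L2Operator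

theorem Matrix.star_mulVec_dotProduct {m n α : Type*} [Fintype m] [Fintype n]
    [CommSemiring α] [StarRing α] (A : Matrix m n α) (x : n → α) (y : m → α) :
    star (A *ᵥ x) ⬝ᵥ y = star x ⬝ᵥ (Aᴴ *ᵥ y) := by
  rw [star_mulVec, dotProduct_mulVec]

theorem Matrix.conjTranspose_map_ofReal {m n : Type*} (A : Matrix m n ℝ) :
    (A.map Complex.ofReal)ᴴ = Aᵀ.map Complex.ofReal := by
  ext i j
  simp

theorem Matrix.map_ofReal_mul {l m n : Type*} [Fintype m] (A : Matrix l m ℝ) (B : Matrix m n ℝ) :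
    (A * B).map Complex.ofReal = A.map Complex.ofReal * B.map Complex.ofReal :=
  Matrix.map_mul (f := Complex.ofRealHom)

theorem Matrix.PosSemidef.map_ofReal_s18 {n : Type*} [Fintype n] [DecidableEq n] {A : Matrix n n ℝ}
    (hA : A.PosSemidef) : (A.map Complex.ofReal).PosSemidef := by
  obtain ⟨B, rfl⟩ := CStarAlgebra.nonneg_iff_eq_star_mul_self.mp hA.nonneg
  rw [star_eq_conjTranspose, map_ofReal_mul, conjTranspose_eq_transpose_of_trivial,
    ← conjTranspose_map_ofReal]
  exact posSemidef_conjTranspose_mul_self _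

theorem Matrix.PosDef.map_ofReal_s18 {n : Type*} [Fintype n] [DecidableEq n] {A : Matrix n n ℝ}
    (hA : A.PosDef) : (A.map Complex.ofReal).PosDef :=
  hA.posSemidef.map_ofReal_s18.posDef_iff_isUnit.mpr
    (hA.isUnit.map (Complex.ofRealHom.mapMatrix (m := n)))

theorem Matrix.re_star_dotProduct_mulVec_of_skew {n : Type*} [Fintype n] {J : Matrix n n ℂ}
    (hJ : Jᴴ = -J) (w : n → ℂ) : (star w ⬝ᵥ (J *ᵥ w)).re = 0 := by
  have h : star (star w ⬝ᵥ (J *ᵥ w)) = -(star w ⬝ᵥ (J *ᵥ w)) := by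
    rw [← star_dotProduct, star_mulVec_dotProduct, hJ, neg_mulVec, dotProduct_neg]
  have h' := congrArg Complex.re h
  simp only [Complex.star_def, Complex.conj_re, Complex.neg_re] at h'
  linarith

/-- Energy balance of a dissipative-Hamiltonian matrix along an eigenvector. -/
theorem Matrix.re_star_dotProduct_dissipation {n : Type*} [Fintype n] {J R Q : Matrix n n ℂ}
    (hJ : Jᴴ = -J) (hQ : Q.PosSemidef) {μ : ℂ} {v : n → ℂ}
    (hv : ((J - R) * Q) *ᵥ v = μ • v) :
    (star (Q *ᵥ v) ⬝ᵥ (R *ᵥ (Q *ᵥ v))).re = -(μ.re * (star v ⬝ᵥ (Q *ᵥ v)).re) := by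
  have h := congrArg (fun x => (star (Q *ᵥ v) ⬝ᵥ x).re) hv
  have hq := (Complex.le_def.mp (hQ.dotProduct_mulVec_nonneg v)).2
  simp only [← mulVec_mulVec, sub_mulVec, dotProduct_sub, dotProduct_smul, Complex.sub_re,
    re_star_dotProduct_mulVec_of_skew hJ, smul_eq_mul, Complex.mul_re,
    star_mulVec_dotProduct Q v v, hQ.isHermitian.eq, ← hq, Complex.zero_im] at h
  linarith

theorem Matrix.isStable_dissipative_hamiltonian_s18 {n : Type*} [Fintype n] [DecidableEq n]
    {J R Q : Matrix n n ℝ} (hJ : Jᵀ = -J) (hR : R.PosSemidef) (hQ : Q.PosDef) :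
    ((J - R) * Q).IsStable := by
  intro μ hμ
  have hmap : ((J - R) * Q).map Complex.ofReal =
      (J.map Complex.ofReal - R.map Complex.ofReal) * Q.map Complex.ofReal := by
    rw [map_ofReal_mul, Matrix.map_sub _ Complex.ofReal_sub]
  have hJc : (J.map Complex.ofReal)ᴴ = -J.map Complex.ofReal := by
    rw [conjTranspose_map_ofReal, hJ]
    ext i j
    simp
  rw [hmap] at hμ ⊢
  have hRc := hR.map_ofReal_s18
  have hQc := hQ.map_ofReal_s18
  generalize J.map Complex.ofReal = J, R.map Complex.ofReal = R, Q.map Complex.ofReal = Q at *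
  refine ⟨?_, fun hre v hv => ?_⟩
  · obtain ⟨v, hv0, hv⟩ := exists_mulVec_eq_zero_iff.mpr hμ
    rw [sub_mulVec, smul_mulVec, one_mulVec, sub_eq_zero] at hv
    have hbal := re_star_dotProduct_dissipation hJc hQc.posSemidef hv
    have hr := (Complex.le_def.mp (hRc.dotProduct_mulVec_nonneg (Q *ᵥ v))).1
    have hq := (Complex.lt_def.mp (hQc.dotProduct_mulVec_pos hv0)).1
    rw [Complex.zero_re] at hr hq
    by_contra! hpos
    nlinarith [mul_pos hpos hq]
  · rw [← mulVec_mulVec] at hv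
    set u := ((J - R) * Q - μ • 1) *ᵥ v with hu
    rw [sub_mulVec, smul_mulVec, one_mulVec, sub_eq_zero] at hv
    have hRu : R *ᵥ (Q *ᵥ u) = 0 := by
      refine (hRc.dotProduct_mulVec_zero_iff _).mp (Complex.ext ?_ ?_)
      · rw [re_star_dotProduct_dissipation hJc hQc.posSemidef hv, hre]
        simp
      · exact (Complex.le_def.mp (hRc.dotProduct_mulVec_nonneg _)).2.symm
    have hJu : J *ᵥ (Q *ᵥ u) = μ • u := by
      rwa [← mulVec_mulVec, sub_mulVec, hRu, sub_zero] at hv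
    have hadj : (J - R)ᴴ *ᵥ (Q *ᵥ u) = -(μ • u) := by
      rw [conjTranspose_sub, hJc, hRc.isHermitian.eq, sub_mulVec, hRu, neg_mulVec, hJu, sub_zero]
    have hconj : star μ = -μ := by
      apply Complex.ext <;> simp [hre]
    have hzero : star u ⬝ᵥ (Q *ᵥ u) = 0 := by
      have hsplit : star (Q *ᵥ u) ⬝ᵥ ((J - R) *ᵥ (Q *ᵥ v)) = μ * (star u ⬝ᵥ (Q *ᵥ v)) := by
        have hflip := star_mulVec_dotProduct (J - R)ᴴ (Q *ᵥ u) (Q *ᵥ v)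
        rw [conjTranspose_conjTranspose] at hflip
        rw [← hflip, hadj, star_neg, star_smul, hconj, neg_smul, neg_neg, smul_dotProduct,
          smul_eq_mul]
      have hexp : star (Q *ᵥ u) ⬝ᵥ u = 0 := by
        have hu' : u = ((J - R) * Q) *ᵥ v - μ • v := by
          rw [hu, sub_mulVec, smul_mulVec, one_mulVec]
        nth_rw 2 [hu']
        rw [dotProduct_sub, ← mulVec_mulVec, hsplit, dotProduct_smul, star_mulVec_dotProduct Q u v,
          hQc.isHermitian.eq, smul_eq_mul, sub_self]
      rwa [star_mulVec_dotProduct, hQc.isHermitian.eq] at hexp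
    by_contra hne
    exact (hQc.dotProduct_mulVec_pos hne).ne' hzero

end

theorem Matrix.mul_family_mul_eq {m n p q α : Type*} [Fintype m] [Fintype n] [Fintype p] [Fintype q]
    [DecidableEq m] [DecidableEq n] [DecidableEq p] [DecidableEq q] [Ring α]
    {B : Matrix n m α} {Bd : Matrix m n α} {C : Matrix p q α} {Cd : Matrix q p α}
    {M : Matrix n q α} (hB : B * Bd * B = B) (hC : C * Cd * C = C)
    (h1 : (1 - B * Bd) * M = 0) (h2 : M * (Cd * C - 1) = 0) (Y Z : Matrix m p α) :
    B * (Bd * M * Cd + (1 - Bd * B) * Y + Z * (1 - C * Cd)) * C = M := by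
  have hBM : B * Bd * M = M := by
    rw [Matrix.sub_mul, Matrix.one_mul, sub_eq_zero] at h1
    exact h1.symm
  have hMC : M * (Cd * C) = M := by
    rwa [Matrix.mul_sub, Matrix.mul_one, sub_eq_zero] at h2
  have hB0 : B * (1 - Bd * B) = 0 := by
    rw [Matrix.mul_sub, Matrix.mul_one, ← Matrix.mul_assoc, hB, sub_self]
  have hC0 : (1 - C * Cd) * C = 0 := by
    rw [Matrix.sub_mul, Matrix.one_mul, hC, sub_self]
  calc B * (Bd * M * Cd + (1 - Bd * B) * Y + Z * (1 - C * Cd)) * C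
      = B * Bd * M * (Cd * C) + B * (1 - Bd * B) * Y * C + B * Z * ((1 - C * Cd) * C) := by
        simp only [Matrix.mul_add, Matrix.add_mul, Matrix.mul_assoc]
    _ = M := by rw [hB0, hC0, hBM, hMC]; simp

/-- the full family of static-output feedbacks associated with a
compatible DH triple. -/
theorem sof_dh_family_stabilizes {n m p : ℕ} (A : Matrix (Fin n) (Fin n) ℝ)
    (B : Matrix (Fin n) (Fin m) ℝ) (Bd : Matrix (Fin m) (Fin n) ℝ)
    (C : Matrix (Fin p) (Fin n) ℝ) (Cd : Matrix (Fin n) (Fin p) ℝ)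
    (hBd : IsMoorePenrose B Bd) (hCd : IsMoorePenrose C Cd)
    (J R Q : Matrix (Fin n) (Fin n) ℝ)
    (hJ : Jᵀ = -J) (hR : R.PosSemidef) (hQ : Q.PosDef)
    (h1 : (1 - B * Bd) * (A - (J - R) * Q) = 0)
    (h2 : (A - (J - R) * Q) * (Cd * C - 1) = 0)
    (Y Z : Matrix (Fin m) (Fin p) ℝ) :
    B * (Bd * (A - (J - R) * Q) * Cd + (1 - Bd * B) * Y + Z * (1 - C * Cd)) * C =
      A - (J - R) * Q ∧
    (A - B * (Bd * (A - (J - R) * Q) * Cd + (1 - Bd * B) * Y + Z * (1 - C * Cd)) * C).IsStable := by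
  have hK := mul_family_mul_eq hBd.1 hCd.1 h1 h2 Y Z
  refine ⟨hK, ?_⟩
  rw [hK, sub_sub_cancel]
  exact isStable_dissipative_hamiltonian_s18 hJ hR hQ
end
end
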